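/- Let n ≥ 1 be an integer and let P ⊆ ℝ^d be a set of exactly n points such that ‖p − q‖₂² ≥ ln n for every two distinct points p, q ∈ P. Then the total sensitivity satisfies ∑_{p ∈ P} s(p) ≥ n/2, where s(p) = sup_{x ∈ ℝ^d} e^{−‖p − x‖₂²} / ∑_{q ∈ P} e^{−‖q − x‖₂²}. In particular, there exist point sets of n points whose total sensitivity with respect to the Gaussian loss is Ω(n). -/

import Mathlib

theorem stmt_4 {d n : ℕ} (hn : 1 ≤ n) (P : Finset (EuclideanSpace ℝ (Fin d)))
    (hcard : P.card = n)
    (hsep : ∀ p ∈ P, ∀ q ∈ P, p ≠ q → Real.log n ≤ ‖p - q‖ ^ 2) :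
    (n : ℝ) / 2 ≤
      ∑ p ∈ P,
        ⨆ x : EuclideanSpace ℝ (Fin d),
          Real.exp (-‖p - x‖ ^ 2) / ∑ q ∈ P, Real.exp (-‖q - x‖ ^ 2) := by
  classical
  have hn0 : (0 : ℝ) < n := by exact_mod_cast hn
  have key : ∀ p ∈ P, (1 / 2 : ℝ) ≤ ⨆ x : EuclideanSpace ℝ (Fin d),
      Real.exp (-‖p - x‖ ^ 2) / ∑ q ∈ P, Real.exp (-‖q - x‖ ^ 2) := by
    intro p hp
    have hbdd : BddAbove (Set.range fun x : EuclideanSpace ℝ (Fin d) =>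
        Real.exp (-‖p - x‖ ^ 2) / ∑ q ∈ P, Real.exp (-‖q - x‖ ^ 2)) := by
      refine ⟨1, ?_⟩
      rintro _ ⟨x, rfl⟩
      refine div_le_one_of_le₀ ?_ (Finset.sum_nonneg fun q _ => (Real.exp_pos _).le)
      exact Finset.single_le_sum (f := fun q => Real.exp (-‖q - x‖ ^ 2))
        (fun q _ => (Real.exp_pos _).le) hp
    refine le_trans ?_ (le_ciSup hbdd p)
    have hpos : 0 < ∑ q ∈ P, Real.exp (-‖q - p‖ ^ 2) :=
      Finset.sum_pos (fun q _ => Real.exp_pos _) ⟨p, hp⟩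
    have h2 : ∑ q ∈ P, Real.exp (-‖q - p‖ ^ 2) ≤ 2 := by
      rw [← Finset.add_sum_erase P _ hp]
      have h3 : ∑ q ∈ P.erase p, Real.exp (-‖q - p‖ ^ 2) ≤ ∑ q ∈ P.erase p, (n : ℝ)⁻¹ := by
        refine Finset.sum_le_sum fun q hq => ?_
        have h := hsep q (Finset.mem_of_mem_erase hq) p hp (Finset.ne_of_mem_erase hq)
        calc Real.exp (-‖q - p‖ ^ 2) ≤ Real.exp (-Real.log n) :=
              Real.exp_le_exp.mpr (by linarith)
          _ = (n : ℝ)⁻¹ := by rw [Real.exp_neg, Real.exp_log hn0]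
      have h4 : ∑ q ∈ P.erase p, (n : ℝ)⁻¹ ≤ 1 := by
        rw [Finset.sum_const, nsmul_eq_mul, ← div_eq_mul_inv, div_le_one hn0]
        exact_mod_cast hcard ▸ Finset.card_erase_le
      have h5 : Real.exp (-‖p - p‖ ^ 2) = 1 := by simp
      linarith
    have h5 : Real.exp (-‖p - p‖ ^ 2) = 1 := by simp
    simp only [h5]
    exact one_div_le_one_div_of_le hpos h2
  have := Finset.sum_le_sum key
  rw [Finset.sum_const, nsmul_eq_mul, hcard] at this
  linarith
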